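/- arXiv:1311.5144 — 8 statements merged into one kernel-verified Lean document; each statement's English description precedes it below -/
import Mathlib

section
/- Let n ≥ 1, let L_R ∈ ℝ^{n×n} be a symmetric positive semidefinite matrix with L_R·1 = 0 (1 denoting the all-ones vector), and let C, K^P ∈ ℝ^{n×n} be diagonal matrices with strictly positive diagonal entries. Then the matrix A = −C(L_R + K^P) is Hurwitz, i.e., every (complex) eigenvalue of A has strictly negative real part. -/
open Matrix

open scoped ComplexOrder

/-- A real positive semidefinite matrix is positive semidefinite over `ℂ`. -/
theorem Matrix.PosSemidef.map_ofReal {ι : Type*} [Fintype ι] {M : Matrix ι ι ℝ}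
    (hM : M.PosSemidef) : (M.map (fun x : ℝ => (x : ℂ))).PosSemidef := by
  classical
  open scoped MatrixOrder in
  obtain ⟨B, hB⟩ := CStarAlgebra.nonneg_iff_eq_star_mul_self.mp hM.nonneg
  have hfactor : M.map (fun x : ℝ => (x : ℂ)) =
      (B.map (fun x : ℝ => (x : ℂ)))ᴴ * B.map (fun x : ℝ => (x : ℂ)) := by
    ext i j
    simp [hB, Matrix.mul_apply, Matrix.star_apply]
  rw [hfactor]
  exact posSemidef_conjTranspose_mul_self _

/-- Every eigenvalue of the negated product of two positive definite matrices has negative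
real part. -/
theorem Matrix.PosDef.re_neg_of_mem_spectrum_neg_mul {ι : Type*} [Fintype ι] [DecidableEq ι]
    {P Q : Matrix ι ι ℂ} (hP : P.PosDef) (hQ : Q.PosDef) {μ : ℂ}
    (hμ : μ ∈ spectrum ℂ (-(P * Q))) : μ.re < 0 := by
  rw [← spectrum_toLin', ← Module.End.hasEigenvalue_iff_mem_spectrum] at hμ
  obtain ⟨v, hv⟩ := hμ.exists_hasEigenvector
  have hv0 : v ≠ 0 := hv.2
  have heig : P *ᵥ (Q *ᵥ v) = -(μ • v) := by
    have h := hv.apply_eq_smul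
    rw [toLin'_apply, neg_mulVec, ← mulVec_mulVec] at h
    rw [← h, neg_neg]
  have hq := hQ.dotProduct_mulVec_pos hv0
  have hQv : Q *ᵥ v ≠ 0 := fun h => by simp [h] at hq
  have hp := hP.dotProduct_mulVec_pos hQv
  have hadj : star (Q *ᵥ v) ⬝ᵥ v = star v ⬝ᵥ (Q *ᵥ v) := by
    rw [star_mulVec, hQ.isHermitian.eq, dotProduct_mulVec]
  rw [heig, dotProduct_neg, dotProduct_smul, hadj, smul_eq_mul] at hp
  obtain ⟨hqre, hqim⟩ := Complex.pos_iff.mp hq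
  have hpre := (Complex.pos_iff.mp hp).1
  rw [Complex.neg_re, Complex.mul_re, ← hqim] at hpre
  nlinarith

/-- **Theorem 1 (stability part), Andreasson et al.**
For an MTDC system `V̇ = -C L_R V + C I^inj + C u` under voltage droop control
`u = K^P (V^nom 1 - V)`, the closed-loop state matrix `A = -C (L_R + K^P)` is Hurwitz:
every complex eigenvalue of `A` has strictly negative real part.
Here `L_R` is symmetric positive semidefinite with `L_R 1 = 0` (a weighted Laplacian),
and `C`, `K^P` are diagonal matrices with strictly positive diagonal entries. -/
theorem droop_state_matrix_is_Hurwitz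
    (n : ℕ) (hn : 1 ≤ n)
    (L_R : Matrix (Fin n) (Fin n) ℝ)
    (hLR_psd : L_R.PosSemidef)
    (hLR_one : L_R *ᵥ (fun _ => (1 : ℝ)) = 0)
    (Cd KPd : Fin n → ℝ)
    (hCd : ∀ i, 0 < Cd i) (hKPd : ∀ i, 0 < KPd i) :
    ∀ μ ∈ spectrum ℂ
        ((-(Matrix.diagonal Cd * (L_R + Matrix.diagonal KPd))).map (fun x : ℝ => (x : ℂ))),
      μ.re < 0 := by
  intro μ hμ
  have hC : (diagonal (fun i => (Cd i : ℂ))).PosDef :=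
    posDef_diagonal_iff.mpr fun i => Complex.zero_lt_real.mpr (hCd i)
  have hK : (diagonal (fun i => (KPd i : ℂ))).PosDef :=
    posDef_diagonal_iff.mpr fun i => Complex.zero_lt_real.mpr (hKPd i)
  refine hC.re_neg_of_mem_spectrum_neg_mul (hK.posSemidef_add hLR_psd.map_ofReal) ?_
  convert hμ using 2
  ext i j
  by_cases h : i = j <;> simp [h]
end

section
/- Let n ≥ 1, let L_R ∈ ℝ^{n×n} be symmetric positive semidefinite with L_R·1 = 0, let C, K^P be diagonal matrices with strictly positive diagonal entries, let V^nom ∈ ℝ and I^inj ∈ ℝ^n. Then L_R + K^P is invertible, and every solution V : ℝ → ℝ^n of the closed-loop droop dynamics V̇(t) = −C(L_R + K^P)V(t) + C K^P V^nom·1 + C I^inj converges as t → ∞ to the unique equilibrium V* = (L_R + K^P)^{-1}(K^P V^nom·1 + I^inj). -/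
open Matrix Filter

/-- Exponential decay of a function satisfying the differential inequality `E' ≤ -r E`. -/
lemma le_mul_exp_of_hasDerivAt_le {E E' : ℝ → ℝ} {r : ℝ}
    (hE : ∀ t, HasDerivAt E (E' t) t) (hle : ∀ t, E' t ≤ -(r * E t)) {t : ℝ} (ht : 0 ≤ t) :
    E t ≤ E 0 * Real.exp (-(r * t)) := by
  have hderiv : ∀ s, HasDerivAt (fun s => E s * Real.exp (r * s))
      (E' s * Real.exp (r * s) + E s * (Real.exp (r * s) * r)) s := fun s =>
    (hE s).mul (by simpa using ((hasDerivAt_id s).const_mul r).exp)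
  have hanti : Antitone fun s => E s * Real.exp (r * s) :=
    antitone_of_hasDerivAt_nonpos hderiv fun s => by
      rw [Pi.zero_apply]
      nlinarith [hle s, Real.exp_pos (r * s)]
  have h := hanti ht
  simp only [mul_zero, Real.exp_zero, mul_one] at h
  rwa [Real.exp_neg, ← div_eq_mul_inv, le_div_iff₀ (Real.exp_pos _)]

/-- Solutions of `ẋ = -diag(c) A x` tend to zero when the quadratic form of `A` dominates a
positive multiple of the Lyapunov function `∑ i, x i ^ 2 / c i`. -/
lemma tendsto_zero_of_hasDerivAt_neg_diagonal_mulVec {ι : Type*} [Fintype ι] [DecidableEq ι]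
    {A : Matrix ι ι ℝ} {c : ι → ℝ} {m : ℝ} (hc : ∀ i, 0 < c i) (hm : 0 < m)
    (hA : ∀ x : ι → ℝ, m * ∑ i, x i ^ 2 / c i ≤ x ⬝ᵥ A *ᵥ x) {x : ℝ → ι → ℝ}
    (hx : ∀ t, HasDerivAt x (-(diagonal c *ᵥ (A *ᵥ x t))) t) :
    Tendsto x atTop (nhds 0) := by
  set E : ℝ → ℝ := fun t => ∑ i, x t i ^ 2 / c i with hEdef
  have hE : ∀ t, HasDerivAt E (-(2 * (x t ⬝ᵥ A *ᵥ x t))) t := by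
    intro t
    have h : HasDerivAt E (∑ i, (2 * x t i * -(c i * (A *ᵥ x t) i)) / c i) t := by
      refine HasDerivAt.fun_sum fun i _ => ?_
      have hi := hasDerivAt_pi.1 (hx t) i
      simp only [Pi.neg_apply, mulVec_diagonal] at hi
      simpa using (hi.fun_pow 2).div_const (c i)
    convert h using 1
    rw [dotProduct, Finset.mul_sum, ← Finset.sum_neg_distrib]
    refine Finset.sum_congr rfl fun i _ => ?_
    have := (hc i).ne'
    field_simp
  have hdecay : ∀ t, 0 ≤ t → E t ≤ E 0 * Real.exp (-(2 * m * t)) := fun t ht =>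
    le_mul_exp_of_hasDerivAt_le hE (fun s => by linarith [hA (x s)]) ht
  refine tendsto_pi_nhds.2 fun i => ?_
  have hexp : Tendsto (fun t : ℝ => c i * (E 0 * Real.exp (-(2 * m * t)))) atTop (nhds 0) := by
    have h : Tendsto (fun t : ℝ => 2 * m * t) atTop atTop :=
      tendsto_id.const_mul_atTop (by positivity)
    simpa using
      ((Real.tendsto_exp_neg_atTop_nhds_zero.comp h).const_mul (E 0)).const_mul (c i)
  have hsq : Tendsto (fun t => x t i ^ 2) atTop (nhds 0) := by
    refine squeeze_zero' (.of_forall fun t => sq_nonneg _) ?_ hexp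
    filter_upwards [eventually_ge_atTop 0] with t ht
    have hterm : x t i ^ 2 / c i ≤ E t :=
      Finset.single_le_sum (f := fun j => x t j ^ 2 / c j)
        (fun j _ => div_nonneg (sq_nonneg _) (hc j).le) (Finset.mem_univ i)
    rw [← div_le_iff₀' (hc i)]
    exact hterm.trans (hdecay t ht)
  have habs := hsq.sqrt
  simp only [Real.sqrt_sq_eq_abs, Real.sqrt_zero] at habs
  exact (tendsto_zero_iff_abs_tendsto_zero _).2 habs

/-- A positive semidefinite matrix plus a positive diagonal one dominates a multiple of any
weighted sum of squares. -/
lemma Matrix.PosSemidef.exists_mul_sum_sq_div_le_add_diagonal {ι : Type*} [Fintype ι]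
    [DecidableEq ι] [Nonempty ι] {L : Matrix ι ι ℝ} (hL : L.PosSemidef) {c k : ι → ℝ}
    (hc : ∀ i, 0 < c i) (hk : ∀ i, 0 < k i) :
    ∃ m, 0 < m ∧ ∀ x : ι → ℝ, m * ∑ i, x i ^ 2 / c i ≤ x ⬝ᵥ (L + diagonal k) *ᵥ x := by
  obtain ⟨i₀, hi₀⟩ := Finite.exists_min fun i => k i * c i
  refine ⟨k i₀ * c i₀, mul_pos (hk i₀) (hc i₀), fun x => ?_⟩
  have hLx : 0 ≤ x ⬝ᵥ L *ᵥ x := by simpa using hL.dotProduct_mulVec_nonneg x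
  have hsum : k i₀ * c i₀ * ∑ i, x i ^ 2 / c i ≤ x ⬝ᵥ diagonal k *ᵥ x := by
    rw [dotProduct, Finset.mul_sum]
    refine Finset.sum_le_sum fun i _ => ?_
    rw [mulVec_diagonal]
    calc k i₀ * c i₀ * (x i ^ 2 / c i) ≤ k i * c i * (x i ^ 2 / c i) :=
          mul_le_mul_of_nonneg_right (hi₀ i) (div_nonneg (sq_nonneg _) (hc i).le)
      _ = x i * (k i * x i) := by
          have := (hc i).ne'
          field_simp
  rw [add_mulVec, dotProduct_add]
  linarith

/-- **Theorem 1 (convergence part), Andreasson et al.**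
For the droop-controlled MTDC closed loop
`V̇ = -C (L_R + K^P) V + C K^P V^nom 1 + C I^inj`,
with `L_R` symmetric positive semidefinite satisfying `L_R 1 = 0` and `C`, `K^P` diagonal
with strictly positive entries, the matrix `L_R + K^P` is invertible,
`V* = (L_R + K^P)⁻¹ (K^P V^nom 1 + I^inj)` is the unique equilibrium, and every solution
of the closed-loop dynamics converges to `V*` as `t → ∞`. -/
theorem droop_closed_loop_converges_to_equilibrium
    (n : ℕ) (hn : 1 ≤ n)
    (L_R : Matrix (Fin n) (Fin n) ℝ)
    (hLR_psd : L_R.PosSemidef)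
    (hLR_one : L_R *ᵥ (fun _ => (1 : ℝ)) = 0)
    (Cd KPd : Fin n → ℝ)
    (hCd : ∀ i, 0 < Cd i) (hKPd : ∀ i, 0 < KPd i)
    (Vnom : ℝ) (Iinj : Fin n → ℝ) :
    IsUnit (L_R + Matrix.diagonal KPd) ∧
    (∀ W : Fin n → ℝ,
        (-(Matrix.diagonal Cd *ᵥ ((L_R + Matrix.diagonal KPd) *ᵥ W))
            + Matrix.diagonal Cd *ᵥ (Matrix.diagonal KPd *ᵥ (fun _ => Vnom))
            + Matrix.diagonal Cd *ᵥ Iinj = 0)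
          ↔ W = (L_R + Matrix.diagonal KPd)⁻¹ *ᵥ
                  (Matrix.diagonal KPd *ᵥ (fun _ => Vnom) + Iinj)) ∧
    (∀ V : ℝ → (Fin n → ℝ),
        (∀ t : ℝ, HasDerivAt V
            (-(Matrix.diagonal Cd *ᵥ ((L_R + Matrix.diagonal KPd) *ᵥ V t))
              + Matrix.diagonal Cd *ᵥ (Matrix.diagonal KPd *ᵥ (fun _ => Vnom))
              + Matrix.diagonal Cd *ᵥ Iinj) t) →
        Tendsto V atTop
          (nhds ((L_R + Matrix.diagonal KPd)⁻¹ *ᵥ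
            (Matrix.diagonal KPd *ᵥ (fun _ => Vnom) + Iinj)))) := by
  have : Nonempty (Fin n) := ⟨⟨0, hn⟩⟩
  have hunit : IsUnit (L_R + diagonal KPd) :=
    (PosDef.posSemidef_add hLR_psd (PosDef.diagonal hKPd)).isUnit
  have hdet := (isUnit_iff_isUnit_det _).1 hunit
  obtain ⟨m, hm, hcoer⟩ := hLR_psd.exists_mul_sum_sq_div_le_add_diagonal hCd hKPd
  set A := L_R + diagonal KPd
  set b := diagonal KPd *ᵥ (fun _ => Vnom) + Iinj with hb
  have hAb : A *ᵥ (A⁻¹ *ᵥ b) = b := by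
    rw [mulVec_mulVec, mul_nonsing_inv _ hdet, one_mulVec]
  have hfield : ∀ W : Fin n → ℝ,
      -(diagonal Cd *ᵥ (A *ᵥ W)) + diagonal Cd *ᵥ (diagonal KPd *ᵥ (fun _ => Vnom))
        + diagonal Cd *ᵥ Iinj = -(diagonal Cd *ᵥ (A *ᵥ (W - A⁻¹ *ᵥ b))) := by
    intro W
    rw [mulVec_sub A, hAb, mulVec_sub, hb, mulVec_add]
    abel
  have hCunit : IsUnit (diagonal Cd) := (PosDef.diagonal hCd).isUnit
  refine ⟨hunit, fun W => ?_, fun V hV => ?_⟩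
  · rw [hfield, neg_eq_zero, ← mulVec_zero (diagonal Cd),
      (mulVec_injective_of_isUnit hCunit).eq_iff, ← mulVec_zero A,
      (mulVec_injective_of_isUnit hunit).eq_iff, sub_eq_zero]
  · refine tendsto_sub_nhds_zero_iff.1 ?_
    refine tendsto_zero_of_hasDerivAt_neg_diagonal_mulVec hCd hm hcoer fun t => ?_
    rw [← hfield]
    exact (hV t).sub_const _
end

section
/- Let n ≥ 1, let L_R ∈ ℝ^{n×n} be symmetric with L_R·1 = 0, let K^P be a diagonal matrix with strictly positive diagonal entries such that L_R + K^P is invertible, let V^nom ∈ ℝ and I^inj ∈ ℝ^n, and let V* = (L_R + K^P)^{-1}(K^P V^nom·1 + I^inj) be the equilibrium voltage of the droop-controlled system. Then the equilibrium controlled injected currents u* = K^P(V^nom·1 − V*) satisfy Σ_{i=1}^n (u*_i + I^inj_i) = 0. -/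
open Matrix

/-- **Theorem 1 (current-balance part), Andreasson et al.**
At the equilibrium `V* = (L_R + K^P)⁻¹ (K^P V^nom 1 + I^inj)` of the droop-controlled MTDC
system, the equilibrium controlled injected currents `u* = K^P (V^nom 1 - V*)` satisfy
`∑ i, (u*_i + I^inj_i) = 0`.  Here `L_R` is symmetric with `L_R 1 = 0`, and `K^P` is diagonal
with strictly positive entries such that `L_R + K^P` is invertible. -/
theorem droop_equilibrium_current_balance
    (n : ℕ) (hn : 1 ≤ n)
    (L_R : Matrix (Fin n) (Fin n) ℝ)
    (hLR_symm : L_R.IsSymm)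
    (hLR_one : L_R *ᵥ (fun _ => (1 : ℝ)) = 0)
    (KPd : Fin n → ℝ) (hKPd : ∀ i, 0 < KPd i)
    (hinv : IsUnit (L_R + Matrix.diagonal KPd))
    (Vnom : ℝ) (Iinj : Fin n → ℝ)
    (Vstar : Fin n → ℝ)
    (hVstar : Vstar = (L_R + Matrix.diagonal KPd)⁻¹ *ᵥ
        (Matrix.diagonal KPd *ᵥ (fun _ => Vnom) + Iinj))
    (ustar : Fin n → ℝ)
    (hustar : ustar = Matrix.diagonal KPd *ᵥ ((fun _ => Vnom) - Vstar)) :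
    ∑ i, (ustar i + Iinj i) = 0 := by
  have hequil : (L_R + Matrix.diagonal KPd) *ᵥ Vstar =
      Matrix.diagonal KPd *ᵥ (fun _ => Vnom) + Iinj := by
    rw [hVstar, Matrix.mulVec_mulVec,
      Matrix.mul_nonsing_inv _ ((Matrix.isUnit_iff_isUnit_det _).mp hinv), Matrix.one_mulVec]
  have hbalance : ustar + Iinj = L_R *ᵥ Vstar := by
    rw [Matrix.add_mulVec] at hequil
    rw [hustar, Matrix.mulVec_sub, sub_add_eq_add_sub, ← hequil, add_sub_cancel_right]
  calc ∑ i, (ustar i + Iinj i) = (fun _ => (1 : ℝ)) ⬝ᵥ (ustar + Iinj) := by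
        simp [dotProduct]
    _ = (L_R *ᵥ fun _ => (1 : ℝ)) ⬝ᵥ Vstar := by
        rw [hbalance, Matrix.dotProduct_mulVec, ← Matrix.mulVec_transpose, hLR_symm.eq]
    _ = 0 := by rw [hLR_one, zero_dotProduct]
end

section
/- Let n ≥ 1, let L_R ∈ ℝ^{n×n} be symmetric positive semidefinite with L_R·1 = 0, let K0 be a diagonal matrix with strictly positive diagonal entries, let V^nom ∈ ℝ and I^inj ∈ ℝ^n. For k > 0 let V*(k) = (L_R + k·K0)^{-1}(k·K0 V^nom·1 + I^inj) denote the equilibrium of the droop-controlled system with gain K^P = k·K0. Then lim_{k→∞} V*(k) = V^nom·1, i.e., in the high-gain limit every converter voltage converges to the nominal voltage. -/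
open Matrix Filter

/-- If `K` is invertible, then `(L + k K)⁻¹ (k K v + w)` tends to `v` as `k → ∞`. -/
theorem tendsto_inv_add_smul_mulVec_atTop {ι : Type*} [Fintype ι] [DecidableEq ι]
    (L K : Matrix ι ι ℝ) (hK : IsUnit K.det) (v w : ι → ℝ) :
    Tendsto (fun k : ℝ => (L + k • K)⁻¹ *ᵥ ((k • K) *ᵥ v + w)) atTop (nhds v) := by
  have hM : Continuous fun ε : ℝ => ε • L + K := by fun_prop
  have hdet : ContinuousAt (fun ε : ℝ => (ε • L + K).det) 0 := hM.matrix_det.continuousAt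
  have hdet0 : ((0 : ℝ) • L + K).det ≠ 0 := by simpa using hK.ne_zero
  have hlim : Tendsto (fun ε : ℝ => (ε • L + K)⁻¹ *ᵥ (K *ᵥ v + ε • w)) (nhds 0) (nhds v) := by
    have hinv : ContinuousAt (fun ε : ℝ => (ε • L + K)⁻¹) 0 := by
      simp only [Matrix.inv_def, Ring.inverse_eq_inv']
      exact (hdet.inv₀ hdet0).smul hM.matrix_adjugate.continuousAt
    have hvec : Continuous fun p : Matrix ι ι ℝ × (ι → ℝ) => p.1 *ᵥ p.2 :=
      continuous_fst.matrix_mulVec continuous_snd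
    have hrhs : ContinuousAt (fun ε : ℝ => K *ᵥ v + ε • w) 0 := by fun_prop
    have h := (hvec.continuousAt.comp (hinv.prodMk hrhs)).tendsto
    simpa [Function.comp_def, Matrix.mulVec_mulVec, Matrix.nonsing_inv_mul K hK] using h
  have hunit : ∀ᶠ k : ℝ in atTop, (k⁻¹ • L + K).det ≠ 0 :=
    tendsto_inv_atTop_zero.eventually (hdet.eventually_ne hdet0)
  refine (hlim.comp tendsto_inv_atTop_zero).congr' ?_
  filter_upwards [hunit, eventually_ne_atTop 0] with k hk hk0
  have hL : L + k • K = Units.mk0 k hk0 • (k⁻¹ • L + K) := by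
    simp [Units.smul_def, smul_smul, hk0]
  have hw : (k • K) *ᵥ v + w = k • (K *ᵥ v + k⁻¹ • w) := by
    simp [smul_smul, hk0, Matrix.smul_mulVec]
  rw [hL, hw, Matrix.inv_smul' _ _ hk.isUnit, Matrix.mulVec_smul, Units.smul_def,
    Matrix.smul_mulVec, smul_smul]
  simp [hk0]

/-- **Theorem 2 (high-gain voltage limit), Andreasson et al.**
For the droop-controlled MTDC system with gains `K^P = k K0` (`K0` diagonal with strictly
positive entries), the equilibrium voltages
`V*(k) = (L_R + k K0)⁻¹ (k K0 V^nom 1 + I^inj)` converge to `V^nom 1` as `k → ∞`.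
Here `L_R` is symmetric positive semidefinite with `L_R 1 = 0`. -/
theorem droop_high_gain_voltage_limit
    (n : ℕ) (hn : 1 ≤ n)
    (L_R : Matrix (Fin n) (Fin n) ℝ)
    (hLR_psd : L_R.PosSemidef)
    (hLR_one : L_R *ᵥ (fun _ => (1 : ℝ)) = 0)
    (K0d : Fin n → ℝ) (hK0d : ∀ i, 0 < K0d i)
    (Vnom : ℝ) (Iinj : Fin n → ℝ) :
    Tendsto
      (fun k : ℝ =>
        (L_R + k • Matrix.diagonal K0d)⁻¹ *ᵥ
          ((k • Matrix.diagonal K0d) *ᵥ (fun _ => Vnom) + Iinj))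
      atTop (nhds (fun _ => Vnom)) := by
  refine tendsto_inv_add_smul_mulVec_atTop L_R (Matrix.diagonal K0d) ?_ _ Iinj
  rw [Matrix.det_diagonal]
  exact (Finset.prod_pos fun i _ => hK0d i).ne'.isUnit
end

section
/- Let n ≥ 1, let L_R ∈ ℝ^{n×n} be symmetric positive semidefinite with L_R·1 = 0, let K0 be a diagonal matrix with strictly positive diagonal entries, let V^nom ∈ ℝ and I^inj ∈ ℝ^n. For k > 0 let V*(k) = (L_R + k·K0)^{-1}(k·K0 V^nom·1 + I^inj) and let u*(k) = k·K0(V^nom·1 − V*(k)) be the equilibrium controlled injected currents of the droop-controlled system with gain K^P = k·K0. Then lim_{k→∞} u*(k) = −I^inj. -/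
open Matrix Filter

/-- If `L 1 = 0` and `L + k • D` is invertible, the droop currents `k D (V 1 - V*)` equal
`-D (k⁻¹ L + D)⁻¹ I`. -/
theorem droop_current_eq {ι : Type*} [Fintype ι] [DecidableEq ι] {L D : Matrix ι ι ℝ}
    (hL : L *ᵥ (fun _ => (1 : ℝ)) = 0) {k : ℝ} (hk : k ≠ 0) (hM : IsUnit (L + k • D).det)
    (V : ℝ) (I : ι → ℝ) :
    (k • D) *ᵥ ((fun _ => V) - (L + k • D)⁻¹ *ᵥ ((k • D) *ᵥ (fun _ => V) + I)) =
      -((D * (k⁻¹ • L + D)⁻¹) *ᵥ I) := by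
  have hLV : L *ᵥ (fun _ => V) = 0 := by
    have hV : (fun _ : ι => V) = V • (fun _ => (1 : ℝ)) := by ext; simp
    rw [hV, mulVec_smul, hL, smul_zero]
  have hDV : (k • D) *ᵥ (fun _ => V) = (L + k • D) *ᵥ (fun _ => V) := by
    rw [add_mulVec, hLV, zero_add]
  have hinv : (k⁻¹ • L + D)⁻¹ = k • (L + k • D)⁻¹ := by
    refine inv_eq_right_inv ?_
    have hfactor : k⁻¹ • L + D = k⁻¹ • (L + k • D) := by
      rw [smul_add, smul_smul, inv_mul_cancel₀ hk, one_smul]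
    rw [hfactor, smul_mul_smul_comm, inv_mul_cancel₀ hk, mul_nonsing_inv _ hM, one_smul]
  rw [hDV, mulVec_add, mulVec_mulVec, nonsing_inv_mul _ hM, one_mulVec, sub_add_cancel_left,
    mulVec_neg, mulVec_mulVec, hinv, smul_mul_assoc, mul_smul_comm]

/-- `D (k⁻¹ L + D)⁻¹ → 1` as `k → ∞` for invertible `D`. -/
theorem tendsto_mul_inv_smul_add_inv {ι : Type*} [Fintype ι] [DecidableEq ι]
    (L : Matrix ι ι ℝ) {D : Matrix ι ι ℝ} (hD : IsUnit D.det) :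
    Tendsto (fun k : ℝ => D * (k⁻¹ • L + D)⁻¹) atTop (nhds 1) := by
  have hsum : Tendsto (fun k : ℝ => k⁻¹ • L + D) atTop (nhds D) := by
    simpa using ((tendsto_inv_atTop_zero (𝕜 := ℝ)).smul_const L).add_const D
  have hinv : ContinuousAt Inv.inv D := by
    refine continuousAt_matrix_inv D ?_
    simpa only [Ring.inverse_eq_inv'] using continuousAt_inv₀ hD.ne_zero
  simpa [mul_nonsing_inv _ hD] using (hinv.tendsto.comp hsum).const_mul D

/-- **Theorem 2 (high-gain current limit), Andreasson et al.**
For the droop-controlled MTDC system with gains `K^P = k K0` (`K0` diagonal with strictly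
positive entries), the equilibrium controlled injected currents
`u*(k) = k K0 (V^nom 1 - V*(k))`, with `V*(k) = (L_R + k K0)⁻¹ (k K0 V^nom 1 + I^inj)`,
converge to `-I^inj` as `k → ∞`.  Here `L_R` is symmetric positive semidefinite with
`L_R 1 = 0`. -/
theorem droop_high_gain_current_limit
    (n : ℕ) (hn : 1 ≤ n)
    (L_R : Matrix (Fin n) (Fin n) ℝ)
    (hLR_psd : L_R.PosSemidef)
    (hLR_one : L_R *ᵥ (fun _ => (1 : ℝ)) = 0)
    (K0d : Fin n → ℝ) (hK0d : ∀ i, 0 < K0d i)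
    (Vnom : ℝ) (Iinj : Fin n → ℝ) :
    Tendsto
      (fun k : ℝ =>
        (k • Matrix.diagonal K0d) *ᵥ
          ((fun _ => Vnom) -
            (L_R + k • Matrix.diagonal K0d)⁻¹ *ᵥ
              ((k • Matrix.diagonal K0d) *ᵥ (fun _ => Vnom) + Iinj)))
      atTop (nhds (-Iinj)) := by
  have hD : (diagonal K0d).PosDef := posDef_diagonal_iff.mpr hK0d
  have hlim : Tendsto (fun k : ℝ => -((diagonal K0d * (k⁻¹ • L_R + diagonal K0d)⁻¹) *ᵥ Iinj))
      atTop (nhds (-Iinj)) := by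
    have hcont : Continuous fun A : Matrix (Fin n) (Fin n) ℝ => -(A *ᵥ Iinj) := by fun_prop
    simpa [Function.comp_def] using (hcont.tendsto 1).comp
      (tendsto_mul_inv_smul_add_inv L_R hD.det_pos.ne'.isUnit)
  refine hlim.congr' ?_
  filter_upwards [eventually_gt_atTop 0] with k hk
  have hM : (L_R + k • diagonal K0d).PosDef := PosDef.posSemidef_add hLR_psd (hD.smul hk)
  exact (droop_current_eq hLR_one hk.ne' hM.det_pos.ne'.isUnit Vnom Iinj).symm
end

section
/- Let n ≥ 1, let L_R ∈ ℝ^{n×n} be symmetric positive semidefinite with L_R·1 = 0 and with kernel exactly span{1}, let K0 be a diagonal matrix with strictly positive diagonal entries, let V^nom ∈ ℝ and I^inj ∈ ℝ^n with Σ_{i=1}^n I^inj_i ≠ 0. For ε > 0 let V*(ε) = (L_R + ε·K0)^{-1}(ε·K0 V^nom·1 + I^inj) denote the equilibrium of the droop-controlled system with gain K^P = ε·K0. Then for every component i, sgn(Σ_{j=1}^n I^inj_j)·V*_i(ε) → +∞ as ε → 0⁺; in particular every converter voltage diverges to sgn(Σ_j I^inj_j)·∞ in the low-gain limit. -/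
open Matrix Filter

/-- For a symmetric matrix whose kernel is spanned by the all-ones vector, every vector is, modulo
the range of the matrix, a multiple of any given vector of nonzero sum. -/
theorem exists_mulVec_add_smul_eq {ι : Type*} [Fintype ι] {L : Matrix ι ι ℝ}
    (hL : L.IsSymm) (hker : ∀ x : ι → ℝ, L *ᵥ x = 0 ↔ ∃ c : ℝ, x = fun _ => c)
    {k : ι → ℝ} (hk : ∑ i, k i ≠ 0) (b : ι → ℝ) :
    ∃ (w : ι → ℝ) (c : ℝ), L *ᵥ w + c • k = b ∧ c * ∑ i, k i = ∑ i, b i := by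
  have hsum : ∀ (x : ι → ℝ) (c : ℝ), ∑ i, (L *ᵥ x + c • k) i = c * ∑ i, k i := by
    intro x c
    have h1 : L *ᵥ (fun _ => 1) = 0 := (hker _).2 ⟨1, rfl⟩
    have h2 : ∑ i, (L *ᵥ x) i = 0 := by
      have h3 : (fun _ => (1 : ℝ)) ⬝ᵥ (L *ᵥ x) = 0 := by
        rw [dotProduct_mulVec, ← mulVec_transpose, hL.eq, h1, zero_dotProduct]
      simpa [dotProduct] using h3
    simp [Finset.sum_add_distrib, h2, Finset.mul_sum]
  let f : (ι → ℝ) →ₗ[ℝ] (ι → ℝ) :=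
    L.mulVecLin + (∑ i, LinearMap.proj (R := ℝ) (φ := fun _ : ι => ℝ) i).smulRight k
  have hf : ∀ x, f x = L *ᵥ x + (∑ i, x i) • k := by
    intro x
    simp [f]
  have hinj : Function.Injective f := by
    rw [injective_iff_map_eq_zero]
    intro x hx
    rw [hf] at hx
    have hs : ∑ i, x i = 0 := by
      have h := hsum x (∑ i, x i)
      rw [hx] at h
      simpa [hk] using h.symm
    rw [hs, zero_smul, add_zero] at hx
    obtain ⟨c, rfl⟩ := (hker x).1 hx
    ext i
    have : Nonempty ι := ⟨i⟩
    simpa using hs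
  obtain ⟨w, hw⟩ := LinearMap.injective_iff_surjective.1 hinj b
  rw [hf] at hw
  exact ⟨w, ∑ i, w i, hw, by rw [← hsum w, hw]⟩

/-- A regularised system `(L + ε K) z = -ε K w` with `L` positive semidefinite and `K` a
nonnegative diagonal matrix has solutions bounded in the `K`-seminorm, uniformly in `ε > 0`. -/
theorem sum_mul_sq_le_of_regularized {ι : Type*} [Fintype ι] [DecidableEq ι]
    {L : Matrix ι ι ℝ} (hL : L.PosSemidef) {k : ι → ℝ} (hk : ∀ i, 0 ≤ k i)
    {ε : ℝ} (hε : 0 < ε) {z w : ι → ℝ}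
    (h : (L + ε • diagonal k) *ᵥ z = -((ε • diagonal k) *ᵥ w)) :
    ∑ i, k i * z i ^ 2 ≤ ∑ i, k i * w i ^ 2 := by
  have hz : 0 ≤ z ⬝ᵥ (L *ᵥ z) := by simpa using hL.dotProduct_mulVec_nonneg z
  have hd : ∀ x : ι → ℝ, z ⬝ᵥ ((ε • diagonal k) *ᵥ x) = ε * ∑ i, k i * (z i * x i) := by
    intro x
    rw [smul_mulVec, dotProduct_smul, smul_eq_mul]
    simp only [dotProduct, mulVec_diagonal]
    congr 1
    exact Finset.sum_congr rfl fun i _ => by ring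
  have he := congrArg (z ⬝ᵥ ·) h
  simp only [add_mulVec, dotProduct_add, dotProduct_neg, hd] at he
  have hle : ∑ i, k i * (z i * z i) + ∑ i, k i * (z i * w i) ≤ 0 := by
    by_contra! hpos
    have := mul_pos hε hpos
    linarith
  have hsq : 0 ≤ ∑ i, k i * (z i + w i) ^ 2 :=
    Finset.sum_nonneg fun i _ => mul_nonneg (hk i) (sq_nonneg _)
  have hexp : ∑ i, k i * (z i + w i) ^ 2 =
      2 * (∑ i, k i * (z i * z i) + ∑ i, k i * (z i * w i))
        - ∑ i, k i * z i ^ 2 + ∑ i, k i * w i ^ 2 := by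
    simp only [Finset.mul_sum, ← Finset.sum_add_distrib, ← Finset.sum_sub_distrib]
    exact Finset.sum_congr rfl fun i _ => by ring
  linarith

/-- **Theorem 2 (low-gain voltage divergence), Andreasson et al.**
For the droop-controlled MTDC system with gains `K^P = ε K0` (`K0` diagonal with strictly
positive entries), if `∑ i, I^inj_i ≠ 0` then every component of the equilibrium voltage
`V*(ε) = (L_R + ε K0)⁻¹ (ε K0 V^nom 1 + I^inj)` diverges to `sgn(∑ i, I^inj_i) ⋅ ∞`
as `ε → 0⁺`.  Here `L_R` is symmetric positive semidefinite with `L_R 1 = 0` and kernel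
exactly `span{1}`. -/
theorem droop_low_gain_voltage_divergence
    (n : ℕ) (hn : 1 ≤ n)
    (L_R : Matrix (Fin n) (Fin n) ℝ)
    (hLR_psd : L_R.PosSemidef)
    (hLR_ker : ∀ x : Fin n → ℝ, L_R *ᵥ x = 0 ↔ ∃ c : ℝ, x = fun _ => c)
    (K0d : Fin n → ℝ) (hK0d : ∀ i, 0 < K0d i)
    (Vnom : ℝ) (Iinj : Fin n → ℝ)
    (hIinj : ∑ i, Iinj i ≠ 0) :
    ∀ i : Fin n,
      Tendsto
        (fun ε : ℝ =>
          Real.sign (∑ j, Iinj j) *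
            ((L_R + ε • Matrix.diagonal K0d)⁻¹ *ᵥ
              ((ε • Matrix.diagonal K0d) *ᵥ (fun _ => Vnom) + Iinj)) i)
        (nhdsWithin 0 (Set.Ioi 0)) atTop := by
  intro i
  have hksum : 0 < ∑ j, K0d j :=
    Finset.sum_pos (fun j _ => hK0d j) ⟨i, Finset.mem_univ i⟩
  obtain ⟨w, c, hdec, hc⟩ := exists_mulVec_add_smul_eq
    (by simpa using hLR_psd.isHermitian) hLR_ker hksum.ne' Iinj
  set s := Real.sign (∑ j, Iinj j) with hs
  have hsc : 0 < s * c := by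
    refine pos_of_mul_pos_left ?_ hksum.le
    rw [mul_assoc, hc]
    exact Real.sign_mul_pos_of_ne_zero _ hIinj
  have hs1 : |s| ≤ 1 := by
    rcases Real.sign_apply_eq (∑ j, Iinj j) with h | h | h <;> simp [hs, h]
  let B := √((∑ j, K0d j * w j ^ 2) / K0d i)
  have hlim : Tendsto (fun ε : ℝ => s * c * ε⁻¹ + (s * (Vnom + w i) - B))
      (nhdsWithin 0 (Set.Ioi 0)) atTop :=
    tendsto_atTop_add_const_right _ _ (tendsto_inv_nhdsGT_zero.const_mul_atTop hsc)
  refine tendsto_atTop_mono' _ ?_ hlim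
  filter_upwards [self_mem_nhdsWithin] with ε hε
  have hε : 0 < ε := hε
  set A := L_R + ε • diagonal K0d with hA
  have hdet : IsUnit A.det := by
    have hpd : A.PosDef := PosDef.posSemidef_add hLR_psd ((PosDef.diagonal hK0d).smul hε)
    exact hpd.det_pos.ne'.isUnit
  set V := A⁻¹ *ᵥ ((ε • diagonal K0d) *ᵥ (fun _ => Vnom) + Iinj) with hV
  have hAV : A *ᵥ V = (ε • diagonal K0d) *ᵥ (fun _ => Vnom) + Iinj := by
    rw [hV, mulVec_mulVec, mul_nonsing_inv _ hdet, one_mulVec]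
  have hAconst : A *ᵥ (fun _ => Vnom + c * ε⁻¹) =
      (ε • diagonal K0d) *ᵥ (fun _ => Vnom) + c • K0d := by
    rw [hA, add_mulVec, (hLR_ker _).2 ⟨_, rfl⟩, zero_add]
    ext j
    simp only [smul_mulVec, Pi.smul_apply, Pi.add_apply, mulVec_diagonal, smul_eq_mul]
    field_simp
  have hz : A *ᵥ (V - (fun _ => Vnom + c * ε⁻¹) - w) = -((ε • diagonal K0d) *ᵥ w) := by
    rw [mulVec_sub, mulVec_sub, hAV, hAconst, ← hdec, hA, add_mulVec]
    abel
  have hbound := sum_mul_sq_le_of_regularized hLR_psd (fun j => (hK0d j).le) hε hz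
  set z := V - (fun _ => Vnom + c * ε⁻¹) - w with hzdef
  have hzi : |z i| ≤ B := by
    refine Real.abs_le_sqrt ?_
    rw [le_div_iff₀ (hK0d i), mul_comm]
    exact (Finset.single_le_sum (f := fun j => K0d j * z j ^ 2)
      (fun j _ => mul_nonneg (hK0d j).le (sq_nonneg _)) (Finset.mem_univ i)).trans hbound
  have hszi : -B ≤ s * z i := by
    refine (abs_le.1 ?_).1
    rw [abs_mul]
    exact (mul_le_of_le_one_left (abs_nonneg _) hs1).trans hzi
  have hVi : V i = Vnom + c * ε⁻¹ + w i + z i := by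
    simp only [hzdef, Pi.sub_apply]
    ring
  rw [hVi]
  linarith
end

section
/- Let n ≥ 1, let L_R ∈ ℝ^{n×n} be symmetric positive semidefinite with L_R·1 = 0 and with kernel exactly span{1}, let K0 be a diagonal matrix with strictly positive diagonal entries, let V^nom ∈ ℝ and I^inj ∈ ℝ^n. For ε > 0 let V*(ε) = (L_R + ε·K0)^{-1}(ε·K0 V^nom·1 + I^inj) and u*(ε) = ε·K0(V^nom·1 − V*(ε)) be the equilibrium controlled injected currents with gain K^P = ε·K0. Then lim_{ε→0⁺} u*(ε) = −((Σ_{i=1}^n I^inj_i)/(Σ_{i=1}^n (K0)_{ii}))·K0·1. -/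
open Matrix Filter

/-- A symmetric matrix annihilating the constant vectors has zero column sums. -/
lemma sum_mulVec_eq_zero_of_isSymm {ι : Type*} [Fintype ι] {L : Matrix ι ι ℝ} (hL : L.IsSymm)
    (h1 : L *ᵥ (fun _ => (1 : ℝ)) = 0) (x : ι → ℝ) : ∑ i, (L *ᵥ x) i = 0 := by
  have h : (fun _ => (1 : ℝ)) ⬝ᵥ (L *ᵥ x) = 0 := by
    rw [dotProduct_mulVec, ← mulVec_transpose, hL.eq, h1, zero_dotProduct]
  simpa [dotProduct] using h

/-- If the kernel of a symmetric matrix consists of the constant vectors, then every vector of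
zero sum lies in its range. -/
lemma exists_mulVec_eq_of_sum_eq_zero {ι : Type*} [Fintype ι] [Nonempty ι]
    {L : Matrix ι ι ℝ} (hL : L.IsSymm)
    (hker : ∀ x : ι → ℝ, L *ᵥ x = 0 ↔ ∃ c : ℝ, x = fun _ => c)
    {b : ι → ℝ} (hb : ∑ i, b i = 0) : ∃ y, L *ᵥ y = b := by
  have hcard : (Fintype.card ι : ℝ) ≠ 0 := by exact_mod_cast Fintype.card_ne_zero
  have h1 : L *ᵥ (fun _ => (1 : ℝ)) = 0 := (hker _).2 ⟨1, rfl⟩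
  let T : (ι → ℝ) →ₗ[ℝ] (ι → ℝ) := (L + of fun _ _ => 1).mulVecLin
  have hT (x : ι → ℝ) (i : ι) : T x i = (L *ᵥ x) i + ∑ j, x j := by
    simp [T, mulVec, dotProduct]
  have hsum (x : ι → ℝ) : ∑ i, T x i = Fintype.card ι * ∑ j, x j := by
    simp [hT, Finset.sum_add_distrib, sum_mulVec_eq_zero_of_isSymm hL h1]
  have hrec (x : ι → ℝ) (hx : ∑ i, T x i = 0) : ∑ j, x j = 0 ∧ L *ᵥ x = T x := by
    have h0 : ∑ j, x j = 0 := (mul_eq_zero.1 ((hsum x).symm.trans hx)).resolve_left hcard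
    exact ⟨h0, funext fun i => by rw [hT, h0, add_zero]⟩
  have hinj : Function.Injective T := by
    rw [injective_iff_map_eq_zero]
    intro x hx
    obtain ⟨h0, h⟩ := hrec x (by simp [hx])
    obtain ⟨c, rfl⟩ := (hker x).1 (h.trans hx)
    have hc : c = 0 := by simpa [hcard] using h0
    simp [hc, funext_iff]
  obtain ⟨y, hy⟩ := LinearMap.injective_iff_surjective.1 hinj b
  exact ⟨y, by rw [(hrec y (by rw [hy, hb])).2, hy]⟩

/-- Energy estimate: the solution of `(L + ε K) r = -ε K y` is bounded in the `K`-weighted norm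
by `y`, uniformly in `ε > 0`. -/
lemma sum_mul_sq_le_of_mulVec_eq {ι : Type*} [Fintype ι] [DecidableEq ι] {L : Matrix ι ι ℝ}
    (hL : L.PosSemidef) {k : ι → ℝ} (hk : ∀ i, 0 < k i) {ε : ℝ} (hε : 0 < ε) {r y : ι → ℝ}
    (h : ∀ i, (L *ᵥ r) i + ε * (k i * r i) = -(ε * (k i * y i))) :
    ∑ i, k i * r i ^ 2 ≤ ∑ i, k i * y i ^ 2 := by
  have h0 : 0 ≤ ∑ i, r i * (L *ᵥ r) i := by
    simpa [dotProduct] using hL.dotProduct_mulVec_nonneg r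
  have h2 : ∑ i, r i * (L *ᵥ r) i = ε * ∑ i, -(k i * r i * (r i + y i)) := by
    rw [Finset.mul_sum]
    exact Finset.sum_congr rfl fun i _ => by linear_combination r i * h i
  have h3 : 0 ≤ ∑ i, -(k i * r i * (r i + y i)) := by
    rw [h2] at h0
    exact nonneg_of_mul_nonneg_right h0 hε
  have h4 : ∑ i, (k i * r i ^ 2 + 2 * -(k i * r i * (r i + y i))) ≤ ∑ i, k i * y i ^ 2 :=
    Finset.sum_le_sum fun i _ => by nlinarith [mul_nonneg (hk i).le (sq_nonneg (r i + y i))]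
  rw [Finset.sum_add_distrib, ← Finset.mul_sum] at h4
  linarith

/-- **Theorem 2 (low-gain current limit / power sharing), Andreasson et al.**
For the droop-controlled MTDC system with gains `K^P = ε K0` (`K0` diagonal with strictly
positive entries), the equilibrium controlled injected currents
`u*(ε) = ε K0 (V^nom 1 - V*(ε))`, with `V*(ε) = (L_R + ε K0)⁻¹ (ε K0 V^nom 1 + I^inj)`,
converge to `-((∑ i, I^inj_i)/(∑ i, (K0)_{ii})) K0 1` as `ε → 0⁺`.  Here `L_R` is symmetric
positive semidefinite with `L_R 1 = 0` and kernel exactly `span{1}`. -/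
theorem droop_low_gain_current_limit
    (n : ℕ) (hn : 1 ≤ n)
    (L_R : Matrix (Fin n) (Fin n) ℝ)
    (hLR_psd : L_R.PosSemidef)
    (hLR_ker : ∀ x : Fin n → ℝ, L_R *ᵥ x = 0 ↔ ∃ c : ℝ, x = fun _ => c)
    (K0d : Fin n → ℝ) (hK0d : ∀ i, 0 < K0d i)
    (Vnom : ℝ) (Iinj : Fin n → ℝ) :
    Tendsto
      (fun ε : ℝ =>
        (ε • Matrix.diagonal K0d) *ᵥ
          ((fun _ => Vnom) -
            (L_R + ε • Matrix.diagonal K0d)⁻¹ *ᵥ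
              ((ε • Matrix.diagonal K0d) *ᵥ (fun _ => Vnom) + Iinj)))
      (nhdsWithin 0 (Set.Ioi 0))
      (nhds (-((∑ i, Iinj i) / (∑ i, K0d i)) •
        (Matrix.diagonal K0d *ᵥ (fun _ => (1 : ℝ))))) := by
  have : Nonempty (Fin n) := ⟨⟨0, hn⟩⟩
  have hsymm : L_R.IsSymm := by simpa [IsHermitian, IsSymm] using hLR_psd.isHermitian
  have hKsum : 0 < ∑ i, K0d i := Finset.sum_pos (fun i _ => hK0d i) Finset.univ_nonempty
  set s : ℝ := (∑ i, Iinj i) / ∑ i, K0d i with hs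
  obtain ⟨y, hy⟩ := exists_mulVec_eq_of_sum_eq_zero hsymm hLR_ker
    (b := fun i => Iinj i - s * K0d i) (by
      rw [Finset.sum_sub_distrib, ← Finset.mul_sum, hs, div_mul_cancel₀ _ hKsum.ne', sub_self])
  rw [tendsto_pi_nhds]
  intro i
  set C : ℝ := ∑ j, K0d j * y j ^ 2
  set B : ℝ := K0d i * (|y i| + √(C / K0d i))
  rw [tendsto_iff_norm_sub_tendsto_zero]
  have hlim : Tendsto (fun ε : ℝ => ε * B) (nhdsWithin 0 (Set.Ioi 0)) (nhds 0) := by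
    have h : Tendsto (fun ε : ℝ => ε * B) (nhds 0) (nhds (0 * B)) := tendsto_id.mul_const B
    rw [zero_mul] at h
    exact h.mono_left nhdsWithin_le_nhds
  refine squeeze_zero' (Eventually.of_forall fun _ => norm_nonneg _) ?_ hlim
  filter_upwards [self_mem_nhdsWithin] with ε hε
  have hε : 0 < ε := hε
  have hunit : IsUnit (L_R + ε • diagonal K0d).det := by
    have hpd : (L_R + ε • diagonal K0d).PosDef :=
      PosDef.posSemidef_add hLR_psd ((PosDef.diagonal hK0d).smul hε)
    exact hpd.det_pos.ne'.isUnit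
  set V := (L_R + ε • diagonal K0d)⁻¹ *ᵥ ((ε • diagonal K0d) *ᵥ (fun _ => Vnom) + Iinj) with hV
  have hVeq (j : Fin n) :
      (L_R *ᵥ V) j + ε * (K0d j * V j) = ε * (K0d j * Vnom) + Iinj j := by
    have h : (L_R + ε • diagonal K0d) *ᵥ V = (ε • diagonal K0d) *ᵥ (fun _ => Vnom) + Iinj := by
      rw [hV, mulVec_mulVec, mul_nonsing_inv _ hunit, one_mulVec]
    simpa [add_mulVec, smul_mulVec, mulVec_diagonal] using congrFun h j
  set r : Fin n → ℝ := V - (fun _ => Vnom + s / ε) - y with hr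
  have hLr : L_R *ᵥ r = L_R *ᵥ V - L_R *ᵥ y := by
    rw [hr, mulVec_sub, mulVec_sub, (hLR_ker _).2 ⟨Vnom + s / ε, rfl⟩, sub_zero]
  have hbound : ∑ j, K0d j * r j ^ 2 ≤ C := by
    refine sum_mul_sq_le_of_mulVec_eq hLR_psd hK0d hε fun j => ?_
    have hεs : ε * (s / ε) = s := mul_div_cancel₀ s hε.ne'
    rw [hLr, hy]
    simp only [hr, Pi.sub_apply]
    linear_combination hVeq j - K0d j * hεs
  have hri : |r i| ≤ √(C / K0d i) := by
    refine Real.abs_le_sqrt ((le_div_iff₀' (hK0d i)).2 (le_trans ?_ hbound))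
    exact Finset.single_le_sum (f := fun j => K0d j * r j ^ 2)
      (fun j _ => mul_nonneg (hK0d j).le (sq_nonneg _)) (Finset.mem_univ i)
  have hdiff : ((ε • diagonal K0d) *ᵥ ((fun _ => Vnom) - V)) i -
      (-s • (diagonal K0d *ᵥ (fun _ => (1 : ℝ)))) i = -(ε * (K0d i * (y i + r i))) := by
    simp only [smul_mulVec, Pi.smul_apply, mulVec_diagonal, Pi.sub_apply, smul_eq_mul, hr]
    field_simp
    ring
  rw [hdiff, norm_neg, Real.norm_eq_abs, abs_mul, abs_mul, abs_of_pos hε, abs_of_pos (hK0d i)]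
  exact mul_le_mul_of_nonneg_left (mul_le_mul_of_nonneg_left
    ((abs_add_le (y i) (r i)).trans (add_le_add_right hri _)) (hK0d i).le) hε.le
end

section
/- Let n ≥ 1, let L_R, L_C ∈ ℝ^{n×n} be symmetric matrices, let C, K^P ∈ ℝ^{n×n} be diagonal matrices with strictly positive diagonal entries, let γ ∈ ℝ, and let K^V ∈ ℝ^{n×n} be any matrix. Define the 2n×2n block matrix A = [[−γ L_C, γ L_C − K^V], [C K^P, −C(L_R + K^P)]]. Then for every s ∈ ℂ, det(s·I_{2n} − A) = det(C K^P) · det( s²·(K^P)^{-1}C^{-1} + s·((K^P)^{-1}L_R + I_n + γ L_C (K^P)^{-1} C^{-1}) + γ L_C (K^P)^{-1} L_R + K^V ), where all real matrices are regarded as complex matrices. -/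
open Matrix

/-- Determinant of a block matrix whose lower blocks are `-P` and a left multiple `P * X` of `P`. -/
theorem Matrix.det_fromBlocks_neg_mul {m R : Type*} [Fintype m] [DecidableEq m] [CommRing R]
    (M B P X : Matrix m m R) :
    (fromBlocks M B (-P) (P * X)).det = P.det * (M * X + B).det := by
  have h_factor : fromBlocks M B (-P) (P * X) *
      (fromBlocks 1 (X - 1) 0 1 * fromBlocks 1 0 1 1 * fromBlocks 1 (-1) 0 1) =
      fromBlocks (M * X + B) (-M) 0 P := by
    have h_sub : -X + (X - 1) = -1 := by abel
    simp [fromBlocks_multiply, h_sub]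
  have h_det := congrArg det h_factor
  simp only [det_mul, det_fromBlocks_zero₂₁, det_fromBlocks_zero₁₂, det_one, mul_one] at h_det
  rw [h_det, mul_comm]

/-- **Characteristic polynomial factorization (proof of Theorem 3), Andreasson et al.**
For the closed-loop matrix
`A = [[-γ L_C, γ L_C - K^V], [C K^P, -C (L_R + K^P)]]` of the distributed averaging
controller, where `L_R`, `L_C` are symmetric, `C`, `K^P` are diagonal with strictly positive
entries, `γ ∈ ℝ` and `K^V` is arbitrary, the characteristic polynomial satisfies, for every
`s ∈ ℂ`,
`det(s I_{2n} - A) = det(C K^P) ⬝ det(s² (K^P)⁻¹ C⁻¹ + s ((K^P)⁻¹ L_R + I + γ L_C (K^P)⁻¹ C⁻¹)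
  + γ L_C (K^P)⁻¹ L_R + K^V)`. -/
theorem distributed_closed_loop_charpoly_factorization
    (n : ℕ) (hn : 1 ≤ n)
    (L_R L_C : Matrix (Fin n) (Fin n) ℝ)
    (hLR_symm : L_R.IsSymm) (hLC_symm : L_C.IsSymm)
    (Cd KPd : Fin n → ℝ)
    (hCd : ∀ i, 0 < Cd i) (hKPd : ∀ i, 0 < KPd i)
    (γ : ℝ) (KV : Matrix (Fin n) (Fin n) ℝ) :
    ∀ s : ℂ,
      Matrix.det
        (s • (1 : Matrix (Fin n ⊕ Fin n) (Fin n ⊕ Fin n) ℂ) -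
          (Matrix.fromBlocks
            (-(γ • L_C)) (γ • L_C - KV)
            (Matrix.diagonal Cd * Matrix.diagonal KPd)
            (-(Matrix.diagonal Cd * (L_R + Matrix.diagonal KPd)))).map
              (fun x : ℝ => (x : ℂ)))
      = Matrix.det ((Matrix.diagonal Cd * Matrix.diagonal KPd).map (fun x : ℝ => (x : ℂ))) *
        Matrix.det
          (s ^ 2 • (((Matrix.diagonal KPd)⁻¹ * (Matrix.diagonal Cd)⁻¹).map
              (fun x : ℝ => (x : ℂ))) +
            s • (((Matrix.diagonal KPd)⁻¹ * L_R + 1 +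
                γ • (L_C * (Matrix.diagonal KPd)⁻¹ * (Matrix.diagonal Cd)⁻¹)).map
                  (fun x : ℝ => (x : ℂ))) +
            (γ • (L_C * (Matrix.diagonal KPd)⁻¹ * L_R) + KV).map (fun x : ℝ => (x : ℂ))) := by
  intro s
  have hC : diagonal Cd * (diagonal Cd)⁻¹ = 1 :=
    mul_nonsing_inv _ (by simp [det_diagonal, Finset.prod_ne_zero_iff, (hCd _).ne'])
  have hK : diagonal KPd * (diagonal KPd)⁻¹ = 1 :=
    mul_nonsing_inv _ (by simp [det_diagonal, Finset.prod_ne_zero_iff, (hKPd _).ne'])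
  generalize (diagonal Cd)⁻¹ = Ci at *
  generalize (diagonal KPd)⁻¹ = Ki at *
  generalize diagonal Cd = C at *
  generalize diagonal KPd = K at *
  have map_smul_real (A : Matrix (Fin n) (Fin n) ℝ) :
      Complex.ofRealHom.mapMatrix (γ • A) = (γ : ℂ) • Complex.ofRealHom.mapMatrix A := by
    ext; simp
  have hC_map := congrArg Complex.ofRealHom.mapMatrix hC
  have hK_map := congrArg Complex.ofRealHom.mapMatrix hK
  rw [fromBlocks_map]
  change det (s • 1 - fromBlocks (Complex.ofRealHom.mapMatrix _) (Complex.ofRealHom.mapMatrix _)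
      (Complex.ofRealHom.mapMatrix _) (Complex.ofRealHom.mapMatrix _)) =
    det (Complex.ofRealHom.mapMatrix _) * det (s ^ 2 • Complex.ofRealHom.mapMatrix _ +
      s • Complex.ofRealHom.mapMatrix _ + Complex.ofRealHom.mapMatrix _)
  simp only [map_mul, map_add, map_sub, map_neg, map_one, map_smul_real] at hC_map hK_map ⊢
  generalize Complex.ofRealHom.mapMatrix C = C at *
  generalize Complex.ofRealHom.mapMatrix Ci = Ci at *
  generalize Complex.ofRealHom.mapMatrix K = K at *
  generalize Complex.ofRealHom.mapMatrix Ki = Ki at *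
  generalize Complex.ofRealHom.mapMatrix L_R = R at *
  generalize Complex.ofRealHom.mapMatrix L_C = L at *
  generalize Complex.ofRealHom.mapMatrix KV = V at *
  have h_blocks : s • (1 : Matrix (Fin n ⊕ Fin n) (Fin n ⊕ Fin n) ℂ) -
      fromBlocks (-((γ : ℂ) • L)) ((γ : ℂ) • L - V) (C * K) (-(C * (R + K))) =
      fromBlocks (s • 1 + (γ : ℂ) • L) (V - (γ : ℂ) • L) (-(C * K))
        (C * K * (s • (Ki * Ci) + Ki * R + 1)) := by
    have h_inv : C * K * (Ki * Ci) = 1 := by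
      rw [mul_assoc, ← mul_assoc K, hK_map, one_mul, hC_map]
    have h_cancel : C * K * (Ki * R) = C * R := by
      rw [mul_assoc, ← mul_assoc K, hK_map, one_mul]
    rw [← fromBlocks_one, fromBlocks_smul, sub_eq_add_neg, fromBlocks_neg, fromBlocks_add]
    congr 1
    · simp
    · simp
    · simp
    · simp only [mul_add, mul_smul_comm, h_inv, h_cancel, mul_one, neg_neg, add_assoc]
  rw [h_blocks, det_fromBlocks_neg_mul, det_mul]
  congr 2
  simp only [mul_add, add_mul, smul_mul_assoc, mul_smul_comm, one_mul, mul_one, mul_assoc]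
  module
end
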